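/- Optimal recovery of the function from its values on W^1H^ω: Let ω be a concave modulus of continuity, E a nontrivial real Banach space, a < b, n ≥ 1. Then the infimum, over all partitions a = t₀ < t₁ < … < t_n = b and all maps Φ: E^{n+1} → ([a,b] → E), of sup_{f ∈ W^1H^ω([a,b],E)} sup_{t∈[a,b]} ‖f(t) − Φ(f(t₀),…,f(t_n))(t)‖ equals (1/4)·∫_0^{(b−a)/n} ω(t) dt. The infimum is attained at the uniform partition t*_k = a + k(b−a)/n, k = 0,…,n, together with the piecewise-linear interpolation method Φ*(y₀,…,y_n)(t) = ((t*_{k+1} − t)·y_k + (t − t*_k)·y_{k+1})·n/(b−a) for t ∈ [t*_k, t*_{k+1}]. -/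

import Mathlib

open MeasureTheory Set

/-- A modulus of continuity: `ω 0 = 0`, continuous, non-decreasing and subadditive on `[0, ∞)`. -/
def IsModulus (ω : ℝ → ℝ) : Prop :=
  ω 0 = 0 ∧ ContinuousOn ω (Set.Ici 0) ∧ MonotoneOn ω (Set.Ici 0) ∧
    ∀ s t : ℝ, 0 ≤ s → 0 ≤ t → ω (s + t) ≤ ω s + ω t

/-- The class `H^ω([a,b], E)`. -/
def HHolder {E : Type*} [NormedAddCommGroup E] (ω : ℝ → ℝ) (a b : ℝ) (f : ℝ → E) : Prop :=
  ∀ s ∈ Set.Icc a b, ∀ t ∈ Set.Icc a b, ‖f t - f s‖ ≤ ω |t - s|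


/-- The class `W¹H^ω([a,b],E)`: `f` is differentiable on `[a,b]` with derivative `f'` belonging
to `H^ω([a,b],E)`. -/
def W1HHolder {E : Type*} [NormedAddCommGroup E] [NormedSpace ℝ E]
    (ω : ℝ → ℝ) (a b : ℝ) (f f' : ℝ → E) : Prop :=
  (∀ t ∈ Set.Icc a b, HasDerivWithinAt f (f' t) (Set.Icc a b) t) ∧ HHolder ω a b f'

/-- A partition `a = t₀ < t₁ < … < t_n = b`. -/
def IsPartition (a b : ℝ) (n : ℕ) (t : ℕ → ℝ) : Prop :=
  t 0 = a ∧ t n = b ∧ ∀ i, i < n → t i < t (i + 1)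

/-- The index of the subinterval of the uniform partition containing `u`. -/
noncomputable def unifIdx (a b : ℝ) (n : ℕ) (u : ℝ) : ℕ :=
  min (n - 1) ⌊(u - a) * n / (b - a)⌋₊

/-- The uniform partition points `t*_k = a + k(b − a)/n`. -/
noncomputable def unifPt (a b : ℝ) (n : ℕ) : ℕ → ℝ :=
  fun k => a + (k : ℝ) * (b - a) / (n : ℝ)

/-- The piecewise-linear interpolation method for the uniform partition:
`Φ*(y₀,…,y_n)(u) = ((t*_{k+1} − u) y_k + (u − t*_k) y_{k+1}) n/(b−a)` for
`u ∈ [t*_k, t*_{k+1}]`. -/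
noncomputable def linMethod {E : Type*} [NormedAddCommGroup E] [NormedSpace ℝ E]
    (a b : ℝ) (n : ℕ) (y : Fin (n + 1) → E) (u : ℝ) : E :=
  if hn : 0 < n then
    ((unifPt a b n (unifIdx a b n u + 1) - u) * (n : ℝ) / (b - a)) •
        y ⟨unifIdx a b n u, by unfold unifIdx; omega⟩ +
      ((u - unifPt a b n (unifIdx a b n u)) * (n : ℝ) / (b - a)) •
        y ⟨unifIdx a b n u + 1, by unfold unifIdx; omega⟩
  else 0

section Interpolation

variable {ω : ℝ → ℝ}

lemma IsModulus.continuous_comp_max (hω : IsModulus ω) : Continuous fun s => ω (max s 0) :=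
  hω.2.1.comp_continuous (by fun_prop) fun _ => mem_Ici.2 (le_max_right _ _)

lemma IsModulus.monotone_comp_max (hω : IsModulus ω) : Monotone fun s => ω (max s 0) :=
  fun _ _ h => hω.2.2.1 (mem_Ici.2 (le_max_right _ _)) (mem_Ici.2 (le_max_right _ _))
    (max_le_max_right 0 h)

lemma IsModulus.nonneg (hω : IsModulus ω) {s : ℝ} (hs : 0 ≤ s) : 0 ≤ ω s :=
  hω.1 ▸ hω.2.2.1 self_mem_Ici hs hs

lemma integral_comp_max_eq {h : ℝ} (hh : 0 ≤ h) :
    ∫ s in (0 : ℝ)..h, ω (max s 0) = ∫ s in (0 : ℝ)..h, ω s := by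
  refine intervalIntegral.integral_congr fun s hs => ?_
  rw [uIcc_of_le hh] at hs
  simp only [max_eq_left hs.1]

/-- The error of linear interpolation on `[c, d]` in the class `W¹H^ω`. -/
lemma norm_sub_linear_interpolation_le {E : Type*} [NormedAddCommGroup E] [NormedSpace ℝ E]
    (hω : IsModulus ω) {a b c d u : ℝ} (hac : a ≤ c) (hdb : d ≤ b) (hcd : c < d)
    (hu : u ∈ Icc c d) {f f' : ℝ → E} (hf : W1HHolder ω a b f f') :
    ‖f u - (((d - u) / (d - c)) • f c + ((u - c) / (d - c)) • f d)‖ ≤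
      (1 / 4) * ∫ s in (0 : ℝ)..(d - c), ω s := by
  obtain ⟨hcu, hud⟩ := hu
  set α := u - c with hα
  set β := d - u with hβ
  have hα0 : 0 ≤ α := by linarith
  have hβ0 : 0 ≤ β := by linarith
  have hH : d - c = α + β := by ring
  have hHpos : 0 < α + β := by linarith
  have mapl : MapsTo (fun x : ℝ => u - α * x) (Icc 0 1) (Icc a b) := fun x hx => by
    constructor <;> nlinarith [hx.1, hx.2]
  have mapr : MapsTo (fun x : ℝ => u + β * x) (Icc 0 1) (Icc a b) := fun x hx => by
    constructor <;> nlinarith [hx.1, hx.2]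
  let G : ℝ → E := fun x => β • (f (u - α * x) - f u) + α • (f (u + β * x) - f u)
  let G' : ℝ → E := fun x => (α * β) • (f' (u + β * x) - f' (u - α * x))
  have hG : ∀ x ∈ Icc (0 : ℝ) 1, HasDerivWithinAt G (G' x) (Icc 0 1) x := by
    intro x hx
    have hl : HasDerivWithinAt (fun x : ℝ => u - α * x) (-α) (Icc 0 1) x := by
      simpa using (((hasDerivAt_id x).const_mul α).const_sub u).hasDerivWithinAt
    have hr : HasDerivWithinAt (fun x : ℝ => u + β * x) β (Icc 0 1) x := by
      simpa using (((hasDerivAt_id x).const_mul β).const_add u).hasDerivWithinAt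
    have h1 := (((hf.1 _ (mapl hx)).scomp x hl mapl).sub_const (f u)).const_smul β
    have h2 := (((hf.1 _ (mapr hx)).scomp x hr mapr).sub_const (f u)).const_smul α
    refine (h1.add h2).congr_deriv ?_
    simp only [G', smul_smul, smul_sub]
    module
  let w : ℝ → ℝ := fun s => ω (max ((α + β) * s) 0)
  have hw : Continuous w := hω.continuous_comp_max.comp (continuous_const_mul (α + β))
  have hB : ∀ x, HasDerivAt (fun x => (α * β) * ∫ s in (0 : ℝ)..x, w s) ((α * β) * w x) x :=
    fun x => (hw.integral_hasStrictDerivAt 0 x).hasDerivAt.const_mul _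
  have key : ‖G 1‖ ≤ (α * β) * ∫ s in (0 : ℝ)..1, w s := by
    refine image_norm_le_of_norm_deriv_right_le_deriv_boundary (f := G) (f' := G')
      (fun x hx => (hG x hx).continuousWithinAt)
      (fun x hx => (hG x (Ico_subset_Icc_self hx)).mono_of_mem_nhdsWithin
        (Icc_mem_nhdsGE_of_mem hx)) (by simp [G]) hB ?_ (right_mem_Icc.2 zero_le_one)
    intro x hx
    have hx' := Ico_subset_Icc_self hx
    have h := hf.2 _ (mapl hx') _ (mapr hx')
    have hnn : 0 ≤ (α + β) * x := mul_nonneg hHpos.le hx.1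
    have he : |u + β * x - (u - α * x)| = max ((α + β) * x) 0 := by
      rw [max_eq_left hnn, show u + β * x - (u - α * x) = (α + β) * x by ring, abs_of_nonneg hnn]
    rw [he] at h
    simp only [G', norm_smul, Real.norm_eq_abs, abs_of_nonneg (mul_nonneg hα0 hβ0)]
    exact mul_le_mul_of_nonneg_left h (mul_nonneg hα0 hβ0)
  have hint : ∫ s in (0 : ℝ)..1, w s = (α + β)⁻¹ * ∫ s in (0 : ℝ)..(α + β), ω s := by
    rw [← integral_comp_max_eq hHpos.le]
    simpa using intervalIntegral.integral_comp_mul_left (a := 0) (b := 1)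
      (fun s => ω (max s 0)) hHpos.ne'
  have hI : 0 ≤ ∫ s in (0 : ℝ)..(α + β), ω s :=
    intervalIntegral.integral_nonneg hHpos.le fun s hs => hω.nonneg hs.1
  have herr : f u - ((β / (d - c)) • f c + (α / (d - c)) • f d) = -((α + β)⁻¹ • G 1) := by
    have h1 : u - α * 1 = c := by ring
    have h2 : u + β * 1 = d := by ring
    have h3 : f u = ((α + β)⁻¹ * (α + β)) • f u := by
      rw [inv_mul_cancel₀ hHpos.ne', one_smul]
    simp only [G, h1, h2, hH]
    nth_rewrite 1 [h3]
    module
  rw [herr, norm_neg, norm_smul, norm_inv, Real.norm_eq_abs, abs_of_pos hHpos, hH]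
  rw [hint] at key
  calc (α + β)⁻¹ * ‖G 1‖
      ≤ (α + β)⁻¹ * (α * β * ((α + β)⁻¹ * ∫ s in (0 : ℝ)..(α + β), ω s)) := by gcongr
    _ = (α * β / (α + β) ^ 2) * ∫ s in (0 : ℝ)..(α + β), ω s := by field_simp
    _ ≤ (1 / 4) * ∫ s in (0 : ℝ)..(α + β), ω s := by
        refine mul_le_mul_of_nonneg_right ?_ hI
        rw [div_le_div_iff₀ (by positivity) (by norm_num)]
        nlinarith [sq_nonneg (α - β)]

lemma unifPt_succ_sub (a b : ℝ) (n k : ℕ) :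
    unifPt a b n (k + 1) - unifPt a b n k = (b - a) / n := by
  unfold unifPt
  push_cast
  ring

lemma isPartition_unifPt {a b : ℝ} (hab : a < b) {n : ℕ} (hn : 0 < n) :
    IsPartition a b n (unifPt a b n) := by
  have hn' : (0 : ℝ) < n := by exact_mod_cast hn
  refine ⟨by simp [unifPt], ?_, fun i _ => ?_⟩
  · unfold unifPt
    field_simp
    ring
  · have := unifPt_succ_sub a b n i
    have : 0 < (b - a) / n := div_pos (sub_pos.2 hab) hn'
    linarith

lemma mem_Icc_unifPt_unifIdx {a b : ℝ} (hab : a < b) {n : ℕ} (hn : 0 < n) {u : ℝ}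
    (hu : u ∈ Icc a b) :
    u ∈ Icc (unifPt a b n (unifIdx a b n u)) (unifPt a b n (unifIdx a b n u + 1)) := by
  have hn' : (0 : ℝ) < n := by exact_mod_cast hn
  have hba : 0 < b - a := sub_pos.2 hab
  set v := (u - a) * n / (b - a) with hv
  have hv0 : 0 ≤ v := div_nonneg (mul_nonneg (sub_nonneg.2 hu.1) hn'.le) hba.le
  have hvn : v ≤ n := by
    rw [hv, div_le_iff₀ hba]
    nlinarith [hu.2]
  have hue : u = a + v * (b - a) / n := by
    rw [hv]
    field_simp
    ring
  have hfloor := Nat.floor_le hv0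
  have hlt := Nat.lt_floor_add_one v
  have hidx : unifIdx a b n u = min (n - 1) ⌊v⌋₊ := rfl
  have hlo : ((unifIdx a b n u : ℕ) : ℝ) ≤ v :=
    le_trans (by rw [hidx]; exact_mod_cast min_le_right _ _) hfloor
  have hhi : v ≤ ((unifIdx a b n u + 1 : ℕ) : ℝ) := by
    rw [hidx]
    rcases le_total (n - 1) ⌊v⌋₊ with h | h
    · rw [min_eq_left h, Nat.sub_add_cancel hn]
      exact hvn
    · rw [min_eq_right h]
      push_cast
      exact hlt.le
  have key : ∀ r s : ℝ, r ≤ s → a + r * (b - a) / n ≤ a + s * (b - a) / n := fun r s hrs => by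
    gcongr
  exact ⟨(key _ _ hlo).trans_eq hue.symm, hue.trans_le (key _ _ hhi)⟩

end Interpolation

section OddHalf

/-- The odd extension of `s ↦ ω (2 s) / 2`. -/
noncomputable def oddHalf (ω : ℝ → ℝ) (y : ℝ) : ℝ :=
  (ω (max (2 * y) 0) - ω (max (-(2 * y)) 0)) / 2

variable {ω : ℝ → ℝ}

lemma oddHalf_neg (y : ℝ) : oddHalf ω (-y) = -oddHalf ω y := by
  unfold oddHalf
  rw [show -(2 * -y) = 2 * y by ring, show 2 * -y = -(2 * y) by ring]
  ring

lemma oddHalf_zero : oddHalf ω 0 = 0 := by simp [oddHalf]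

lemma IsModulus.continuous_oddHalf (hω : IsModulus ω) : Continuous (oddHalf ω) := by
  have h := hω.continuous_comp_max
  unfold oddHalf
  exact ((h.comp (continuous_const_mul 2)).sub
    (h.comp (continuous_const_mul 2).neg)).div_const 2

lemma IsModulus.monotone_oddHalf (hω : IsModulus ω) : Monotone (oddHalf ω) := fun x y hxy => by
  have h1 := hω.monotone_comp_max (show 2 * x ≤ 2 * y by linarith)
  have h2 := hω.monotone_comp_max (show -(2 * y) ≤ -(2 * x) by linarith)
  simp only at h1 h2
  unfold oddHalf
  linarith

lemma IsModulus.oddHalf_of_nonneg (hω : IsModulus ω) {y : ℝ} (hy : 0 ≤ y) :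
    oddHalf ω y = ω (2 * y) / 2 := by
  unfold oddHalf
  rw [max_eq_left (by linarith), max_eq_right (by linarith), hω.1, sub_zero]

lemma IsModulus.oddHalf_sub_le_of_nonneg (hω : IsModulus ω) {x y : ℝ} (hx : 0 ≤ x)
    (hxy : x ≤ y) : oddHalf ω y - oddHalf ω x ≤ ω (y - x) := by
  rw [hω.oddHalf_of_nonneg hx, hω.oddHalf_of_nonneg (hx.trans hxy)]
  have h1 := hω.2.2.2 (y - x) (y - x) (by linarith) (by linarith)
  have h2 := hω.2.2.2 (2 * x) ((y - x) + (y - x)) (by linarith) (by linarith)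
  rw [show 2 * x + ((y - x) + (y - x)) = 2 * y by ring] at h2
  linarith

lemma IsModulus.oddHalf_sub_le (hω : IsModulus ω) (hconc : ConcaveOn ℝ (Ici 0) ω) {x y : ℝ}
    (hxy : x ≤ y) : oddHalf ω y - oddHalf ω x ≤ ω (y - x) := by
  rcases le_total 0 x with hx | hx
  · exact hω.oddHalf_sub_le_of_nonneg hx hxy
  rcases le_total y 0 with hy | hy
  · have := hω.oddHalf_sub_le_of_nonneg (neg_nonneg.2 hy) (neg_le_neg hxy)
    rw [oddHalf_neg, oddHalf_neg, show -x - -y = y - x by ring] at this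
    linarith
  · have h := hconc.2 (show 2 * y ∈ Ici (0 : ℝ) from mem_Ici.2 (by linarith))
      (show 2 * -x ∈ Ici (0 : ℝ) from mem_Ici.2 (by linarith))
      (show (0 : ℝ) ≤ 1 / 2 by norm_num) (show (0 : ℝ) ≤ 1 / 2 by norm_num) (by norm_num)
    simp only [smul_eq_mul] at h
    rw [show 1 / 2 * (2 * y) + 1 / 2 * (2 * -x) = y - x by ring] at h
    have h1 := oddHalf_neg (ω := ω) x
    rw [hω.oddHalf_of_nonneg (neg_nonneg.2 hx)] at h1
    rw [hω.oddHalf_of_nonneg hy]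
    linarith

lemma IsModulus.abs_oddHalf_sub_le (hω : IsModulus ω) (hconc : ConcaveOn ℝ (Ici 0) ω) (x y : ℝ) :
    |oddHalf ω x - oddHalf ω y| ≤ ω |x - y| := by
  wlog h : y ≤ x generalizing x y
  · rw [abs_sub_comm, abs_sub_comm x]
    exact this y x (le_of_not_ge h)
  · rw [abs_of_nonneg (sub_nonneg.2 (hω.monotone_oddHalf h)), abs_of_nonneg (sub_nonneg.2 h)]
    exact hω.oddHalf_sub_le hconc h

lemma IsModulus.integral_oddHalf (hω : IsModulus ω) {s : ℝ} (hs : 0 ≤ s) :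
    ∫ y in (0 : ℝ)..s, oddHalf ω y = (1 / 4) * ∫ y in (0 : ℝ)..(2 * s), ω y := by
  have h1 : ∫ y in (0 : ℝ)..s, oddHalf ω y = ∫ y in (0 : ℝ)..s, ω (2 * y) / 2 :=
    intervalIntegral.integral_congr fun y hy => by
      rw [uIcc_of_le hs] at hy
      exact hω.oddHalf_of_nonneg hy.1
  rw [h1, intervalIntegral.integral_div, intervalIntegral.integral_comp_mul_left _ two_ne_zero,
    mul_zero, smul_eq_mul]
  ring

lemma IsModulus.integral_oddHalf_mono (hω : IsModulus ω) {r s : ℝ} (hr : 0 ≤ r) (hrs : r ≤ s) :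
    ∫ y in (0 : ℝ)..r, oddHalf ω y ≤ ∫ y in (0 : ℝ)..s, oddHalf ω y := by
  have hint := fun p q : ℝ => hω.continuous_oddHalf.intervalIntegrable (μ := volume) p q
  rw [← intervalIntegral.integral_add_adjacent_intervals (hint 0 r) (hint r s)]
  have : 0 ≤ ∫ y in r..s, oddHalf ω y := intervalIntegral.integral_nonneg hrs fun y hy =>
    oddHalf_zero (ω := ω) ▸ hω.monotone_oddHalf (hr.trans hy.1)
  linarith

end OddHalf

section Knots

/-- A solution of a system of equations `G i z = 0` on a box, when each `G i` is antitone in the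
coordinates other than the `i`-th one and has the right signs on the `i`-th faces. -/
lemma exists_zero_of_offDiagonal_antitone {ι : Type*} [DecidableEq ι] (I : Finset ι)
    {lo hi : ι → ℝ} (hle : lo ≤ hi) {G : ι → (ι → ℝ) → ℝ} (hG : ∀ i ∈ I, Continuous (G i))
    (hanti : ∀ i ∈ I, ∀ z y, z ≤ y → z i = y i → G i y ≤ G i z)
    (hlo : ∀ i ∈ I, ∀ z ∈ Icc lo hi, z i = lo i → G i z ≤ 0)
    (hhi : ∀ i ∈ I, ∀ z ∈ Icc lo hi, z i = hi i → 0 ≤ G i z) :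
    ∃ z ∈ Icc lo hi, ∀ i ∈ I, G i z = 0 := by
  let S : Set (ι → ℝ) := Icc lo hi ∩ {z | ∀ i ∈ I, G i z ≤ 0}
  have hbox : IsCompact (Icc lo hi) := by
    rw [← pi_univ_Icc]
    exact isCompact_univ_pi fun _ => isCompact_Icc
  have hclosed : IsClosed {z : ι → ℝ | ∀ i ∈ I, G i z ≤ 0} := by
    simp only [ofPred_forall]
    exact isClosed_biInter fun i hi => isClosed_le (hG i hi) continuous_const
  have hlo_mem : lo ∈ Icc lo hi := ⟨le_rfl, hle⟩
  obtain ⟨z, hz, hmax⟩ := (hbox.inter_right hclosed).exists_isMaxOn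
    ⟨lo, hlo_mem, fun i hi => hlo i hi lo hlo_mem rfl⟩
    (f := fun z : ι → ℝ => ∑ i ∈ I, z i) (by fun_prop)
  refine ⟨z, hz.1, fun i hi' => (hz.2 i hi').antisymm ?_⟩
  by_contra! hneg
  have hzi : z i < hi i := lt_of_le_of_ne (hz.1.2 i) fun h => hneg.not_ge (hhi i hi' z hz.1 h)
  have hcont : Continuous fun s => G i (Function.update z i s) :=
    (hG i hi').comp (continuous_const.update i continuous_id)
  have hev : ∀ᶠ s in nhdsWithin (z i) (Ioi (z i)), G i (Function.update z i s) < 0 := by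
    refine Filter.Eventually.filter_mono nhdsWithin_le_nhds (hcont.continuousAt.eventually_lt
      continuousAt_const ?_)
    simpa using hneg
  obtain ⟨s, hs, hsmem⟩ := (hev.and (Ioo_mem_nhdsGT hzi)).exists
  have hzle : z ≤ Function.update z i s := by
    rw [le_update_iff]
    exact ⟨hsmem.1.le, fun _ _ => le_rfl⟩
  have hmem : Function.update z i s ∈ S := by
    refine ⟨⟨hz.1.1.trans hzle, ?_⟩, fun j hj => ?_⟩
    · rw [update_le_iff]
      exact ⟨hsmem.2.le, fun j _ => hz.1.2 j⟩
    · rcases eq_or_ne j i with rfl | hji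
      · exact hs.le
      · exact (hanti j hj _ _ hzle (by simp [hji])).trans (hz.2 j hj)
  have hlt : ∑ j ∈ I, z j < ∑ j ∈ I, Function.update z i s j :=
    Finset.sum_lt_sum (fun j _ => hzle j) ⟨i, hi', by simpa using hsmem.1⟩
  exact (hmax hmem).not_gt hlt

lemma IsPartition.le_of_le {a b : ℝ} {n : ℕ} {t : ℕ → ℝ} (ht : IsPartition a b n t) {i j : ℕ}
    (hij : i ≤ j) (hj : j ≤ n) : t i ≤ t j := by
  induction j, hij using Nat.le_induction with
  | base => exact le_rfl
  | succ j _ ih => exact (ih (by omega)).trans (ht.2.2 j (by omega)).le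

lemma IsPartition.mem_Icc {a b : ℝ} {n : ℕ} {t : ℕ → ℝ} (ht : IsPartition a b n t) {i : ℕ}
    (hi : i ≤ n) : t i ∈ Icc a b :=
  ⟨ht.1 ▸ ht.le_of_le (Nat.zero_le i) hi, ht.2.1 ▸ ht.le_of_le hi le_rfl⟩

/-- Every partition admits interlacing knots for which the corresponding perfect spline built from
`φ` has mean zero on each interval of the partition. -/
lemma exists_knots {φ : ℝ → ℝ} (hφ : Continuous φ) (hmono : Monotone φ) (hφ0 : φ 0 = 0)
    {a b : ℝ} (hab : a ≤ b) {n : ℕ} {t : ℕ → ℝ} (ht : IsPartition a b n t) :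
    ∃ z : ℕ → ℝ, Monotone z ∧ z 0 = 2 * a - b ∧ z (n + 1) = 2 * b - a ∧
      (∀ i ≤ n, t i ∈ Icc (z i) (z (i + 1))) ∧
      ∀ i < n, ∫ x in (t i)..(t (i + 1)),
        φ (max (min (z (i + 1) - x) (x - z i)) (x - z (i + 2))) = 0 := by
  let lo : ℕ → ℝ := fun i => if i = 0 then 2 * a - b else if i ≤ n then t (i - 1) else 2 * b - a
  let hi : ℕ → ℝ := fun i => if i = 0 then 2 * a - b else if i ≤ n then t i else 2 * b - a
  let G : ℕ → (ℕ → ℝ) → ℝ := fun i z => ∫ x in (t (i - 1))..(t i),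
    φ (max (min (z i - x) (x - z (i - 1))) (x - z (i + 1)))
  have hlohi : lo ≤ hi := fun i => by
    simp only [lo, hi]
    split_ifs with h0 hn
    · exact le_rfl
    · exact ht.le_of_le (Nat.sub_le i 1) hn
    · exact le_rfl
  have hhit : ∀ i ≤ n, hi i ≤ t i := fun i hin => by
    have := ht.mem_Icc hin
    simp only [hi, if_pos hin]
    split_ifs
    · linarith [this.1]
    · exact le_rfl
  have hlot : ∀ i ≤ n, t i ≤ lo (i + 1) := fun i hin => by
    have := ht.mem_Icc hin
    simp only [lo, Nat.add_eq_zero_iff, one_ne_zero, and_false, if_false, Nat.add_sub_cancel]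
    split_ifs
    · exact le_rfl
    · linarith [this.2]
  have hhilo : ∀ i, hi i ≤ lo (i + 1) := fun i => by
    rcases le_or_gt i n with hin | hin
    · exact (hhit i hin).trans (hlot i hin)
    · simp [hi, lo, show i ≠ 0 by omega, show ¬ i ≤ n by omega, show ¬ i + 1 ≤ n by omega]
  have hcont : ∀ z : ℕ → ℝ, ∀ i, Continuous fun x : ℝ =>
      φ (max (min (z i - x) (x - z (i - 1))) (x - z (i + 1))) := fun z i =>
    hφ.comp (by fun_prop)
  have htle : ∀ i ∈ Finset.Icc 1 n, t (i - 1) ≤ t i := fun i hin =>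
    ht.le_of_le (Nat.sub_le i 1) (Finset.mem_Icc.1 hin).2
  obtain ⟨z, ⟨hzlo, hzhi⟩, hz⟩ := exists_zero_of_offDiagonal_antitone (Finset.Icc 1 n)
    hlohi (G := G)
    (fun i _ => intervalIntegral.continuous_parametric_intervalIntegral_of_continuous'
      (f := fun (z : ℕ → ℝ) x => φ (max (min (z i - x) (x - z (i - 1))) (x - z (i + 1))))
      (hφ.comp (by fun_prop)) _ _)
    (fun i hin z y hzy hzyi => by
      refine intervalIntegral.integral_mono_on (htle i hin)
        ((hcont y i).intervalIntegrable _ _) ((hcont z i).intervalIntegrable _ _) fun x _ => ?_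
      have h1 := hzy (i - 1)
      have h2 := hzy (i + 1)
      apply hmono
      rw [hzyi]
      gcongr)
    (fun i hin z hz hzi => by
      have h1 := Finset.mem_Icc.1 hin
      have h2 : z i ≤ t (i - 1) := by
        rw [hzi]
        have := hlohi i
        simp [lo, show i ≠ 0 by omega, h1.2]
      refine (intervalIntegral.integral_mono_on (htle i hin) ((hcont z i).intervalIntegrable _ _)
        (intervalIntegrable_const (c := 0)) fun x hx => hφ0 ▸ hmono ?_).trans_eq (by simp)
      have h3 := (hlot i h1.2).trans (hz.1 (i + 1))
      exact max_le ((min_le_left _ _).trans (by linarith [hx.1])) (by linarith [hx.2]))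
    (fun i hin z hz hzi => by
      have h1 := Finset.mem_Icc.1 hin
      have h2 : t i ≤ z i := by
        rw [hzi]
        simp [hi, show i ≠ 0 by omega, h1.2]
      refine intervalIntegral.integral_nonneg (htle i hin) fun x hx => hφ0 ▸ hmono ?_
      have h3 := (hz.2 (i - 1)).trans (hhit (i - 1) (by omega))
      exact le_max_of_le_left (le_min (by linarith [hx.2]) (by linarith [hx.1])))
  refine ⟨z, monotone_nat_of_le_succ fun i => (hzhi i).trans ((hhilo i).trans (hzlo (i + 1))),
    ?_, ?_, fun i hin => ⟨(hzhi i).trans (hhit i hin), (hlot i hin).trans (hzlo (i + 1))⟩,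
    fun i hin => ?_⟩
  · have h1 := hzlo 0
    have h2 := hzhi 0
    simp only [lo, hi, if_true] at h1 h2
    exact h2.antisymm h1
  · have h1 := hzlo (n + 1)
    have h2 := hzhi (n + 1)
    simp [lo, hi] at h1 h2
    linarith
  · exact hz (i + 1) (Finset.mem_Icc.2 ⟨by omega, by omega⟩)

end Knots

section Zigzag

/-- Up to sign, the distance to the points `z 0, …, z k`, with sign changes at these points. -/
noncomputable def zigzag (z : ℕ → ℝ) : ℕ → ℝ → ℝ
  | 0, x => z 0 - x
  | k + 1, x => min (-zigzag z k x) (z (k + 1) - x)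

variable {z : ℕ → ℝ}

lemma abs_zigzag_sub_le (k : ℕ) (x y : ℝ) : |zigzag z k x - zigzag z k y| ≤ |x - y| := by
  induction k with
  | zero => simp [zigzag, abs_sub_comm]
  | succ k ih =>
    refine (abs_min_sub_min_le_max _ _ _ _).trans (max_le ?_ ?_)
    · rwa [neg_sub_neg, abs_sub_comm]
    · simp [abs_sub_comm]

lemma zigzag_le (k : ℕ) (x : ℝ) : zigzag z k x ≤ z k - x := by
  cases k with
  | zero => exact le_rfl
  | succ k => exact min_le_right _ _

lemma le_zigzag (hz : Monotone z) {k : ℕ} {x : ℝ} (hx : x ≤ z k) : x - z k ≤ zigzag z k x := by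
  cases k with
  | zero => simp only [zigzag]; linarith
  | succ k =>
    have := zigzag_le (z := z) k x
    have := hz (Nat.le_succ k)
    exact le_min (by linarith) (by linarith)

lemma zigzag_of_ge (hz : Monotone z) {k : ℕ} {x : ℝ} (hx : z k ≤ x) :
    zigzag z k x = z k - x := by
  induction k with
  | zero => rfl
  | succ k ih =>
    have h := (hz (Nat.le_succ k)).trans hx
    rw [zigzag, ih h]
    exact min_eq_right (by linarith)

lemma zigzag_succ_of_ge (hz : Monotone z) {k : ℕ} {x : ℝ} (hx : z k ≤ x) :
    zigzag z (k + 1) x = min (x - z k) (z (k + 1) - x) := by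
  rw [zigzag, zigzag_of_ge hz hx, neg_sub]

lemma zigzag_succ_of_le (hz : Monotone z) {k : ℕ} {x : ℝ} (hx : x ≤ z k) :
    zigzag z (k + 1) x = -zigzag z k x := by
  have := le_zigzag hz hx
  have := hz (Nat.le_succ k)
  exact min_eq_left (by linarith)

lemma exists_sign_zigzag_eq (hz : Monotone z) {k m : ℕ} (hkm : k ≤ m) :
    ∃ ε : ℝ, (ε = 1 ∨ ε = -1) ∧ ∀ x ≤ z k, zigzag z m x = ε * zigzag z k x := by
  induction m, hkm using Nat.le_induction with
  | base => exact ⟨1, Or.inl rfl, fun x _ => (one_mul _).symm⟩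
  | succ m hkm ih =>
    obtain ⟨ε, hε, h⟩ := ih
    refine ⟨-ε, ?_, fun x hx => ?_⟩
    · rcases hε with rfl | rfl <;> simp
    · rw [zigzag_succ_of_le hz (hx.trans (hz hkm)), h x hx, neg_mul]

lemma exists_sign_integral_comp_zigzag_eq (hz : Monotone z) {φ : ℝ → ℝ}
    (hodd : ∀ y, φ (-y) = -φ y) {k m : ℕ} (hkm : k ≤ m) :
    ∃ ε : ℝ, |ε| = 1 ∧ ∀ p q, p ≤ q → q ≤ z k →
      ∫ x in p..q, φ (zigzag z m x) = ε * ∫ x in p..q, φ (zigzag z k x) := by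
  obtain ⟨ε, hε, h⟩ := exists_sign_zigzag_eq hz hkm
  refine ⟨ε, by rcases hε with rfl | rfl <;> simp, fun p q hpq hq => ?_⟩
  rw [← intervalIntegral.integral_const_mul]
  refine intervalIntegral.integral_congr fun x hx => ?_
  rw [uIcc_of_le hpq] at hx
  simp only [h x (hx.2.trans hq)]
  rcases hε with rfl | rfl
  · simp
  · simp [hodd]

lemma integral_comp_min_sub {φ : ℝ → ℝ} (hφ : Continuous φ) {p q : ℝ} (hpq : p ≤ q) :
    ∫ x in p..q, φ (min (x - p) (q - x)) = 2 * ∫ y in (0 : ℝ)..((q - p) / 2), φ y := by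
  have hint := fun r s : ℝ => (hφ.comp (show Continuous fun x : ℝ => min (x - p) (q - x) by
    fun_prop)).intervalIntegrable (μ := volume) r s
  simp only [Function.comp_def] at hint
  rw [← intervalIntegral.integral_add_adjacent_intervals (hint p ((p + q) / 2)) (hint _ q)]
  have h1 : ∫ x in p..((p + q) / 2), φ (min (x - p) (q - x)) =
      ∫ x in p..((p + q) / 2), φ (x - p) := by
    refine intervalIntegral.integral_congr fun x hx => ?_
    rw [uIcc_of_le (by linarith)] at hx
    rw [min_eq_left (by linarith [hx.2])]
  have h2 : ∫ x in ((p + q) / 2)..q, φ (min (x - p) (q - x)) =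
      ∫ x in ((p + q) / 2)..q, φ (q - x) := by
    refine intervalIntegral.integral_congr fun x hx => ?_
    rw [uIcc_of_le (by linarith)] at hx
    rw [min_eq_right (by linarith [hx.1])]
  rw [h1, h2, intervalIntegral.integral_comp_sub_right, intervalIntegral.integral_comp_sub_left,
    sub_self, sub_self, show (p + q) / 2 - p = (q - p) / 2 by ring,
    show q - (p + q) / 2 = (q - p) / 2 by ring]
  ring

end Zigzag

section LowerBound

lemma exists_large_gap {a b : ℝ} {n : ℕ} (hn : 0 < n) (z : ℕ → ℝ) :
    (b - a) / n / 2 ≤ z 1 - a ∨ (b - a) / n / 2 ≤ b - z n ∨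
      ∃ k, 1 ≤ k ∧ k < n ∧ (b - a) / n / 2 ≤ (z (k + 1) - z k) / 2 := by
  by_contra! h
  obtain ⟨h1, h2, h3⟩ := h
  have hn' : (0 : ℝ) < n := by exact_mod_cast hn
  set d := (b - a) / n with hd
  have hdn : b - a = n * d := by
    rw [hd]
    field_simp
  have key : ∀ k, k < n → z (k + 1) ≤ z 1 + k * d := by
    intro k
    induction k with
    | zero => simp
    | succ k ih =>
      intro hk
      have := ih (by omega)
      have := h3 (k + 1) (by omega) hk
      push_cast
      linarith
  obtain ⟨m, rfl⟩ := Nat.exists_eq_add_of_lt hn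
  simp only [zero_add] at *
  have := key m (by omega)
  push_cast at hdn
  linarith

/-- A function in `H^ω` with mean zero on each interval of a given partition and whose primitive
is uniformly large. -/
lemma exists_holder_integral_eq_zero {ω : ℝ → ℝ} (hω : IsModulus ω)
    (hconc : ConcaveOn ℝ (Ici 0) ω) {a b : ℝ} (hab : a < b) {n : ℕ} (hn : 0 < n) {t : ℕ → ℝ}
    (ht : IsPartition a b n t) :
    ∃ g : ℝ → ℝ, Continuous g ∧ (∀ x y, |g x - g y| ≤ ω |x - y|) ∧
      (∀ i ≤ n, ∫ x in a..(t i), g x = 0) ∧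
      ∃ u ∈ Icc a b, (1 / 4) * ∫ s in (0 : ℝ)..((b - a) / n), ω s ≤ |∫ x in a..u, g x| := by
  have hφ := hω.continuous_oddHalf
  obtain ⟨z, hz, hz0, hzn, hzt, hzero⟩ :=
    exists_knots hφ hω.monotone_oddHalf oddHalf_zero hab.le ht
  set φ := oddHalf ω with hφdef
  have hEcont : ∀ k, Continuous (zigzag z k) := fun k =>
    (LipschitzWith.mk_one fun x y => by
      simpa only [Real.dist_eq] using abs_zigzag_sub_le k x y).continuous
  have hzmem : ∀ k, 1 ≤ k → k ≤ n → z k ∈ Icc a b := fun k hk hkn => by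
    have h1 := (hzt (k - 1) (by omega)).2
    rw [Nat.sub_add_cancel hk] at h1
    exact ⟨(ht.mem_Icc (by omega)).1.trans h1, (hzt k hkn).1.trans (ht.mem_Icc hkn).2⟩
  let g : ℝ → ℝ := fun x => φ (zigzag z (n + 1) x)
  have hg : Continuous g := hφ.comp (hEcont _)
  have hint := fun p q : ℝ => hg.intervalIntegrable (μ := volume) p q
  have hstep : ∀ i < n, ∫ x in (t i)..(t (i + 1)), g x = 0 := by
    intro i hi
    obtain ⟨ε, -, hε⟩ := exists_sign_integral_comp_zigzag_eq hz (oddHalf_neg (ω := ω))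
      (show i + 2 ≤ n + 1 by omega)
    rw [hε _ _ (ht.2.2 i hi).le (hzt (i + 1) hi).2]
    refine mul_eq_zero_of_right _ (neg_eq_zero.1 ?_)
    rw [← hzero i hi, ← intervalIntegral.integral_neg]
    refine intervalIntegral.integral_congr fun x hx => ?_
    rw [uIcc_of_le (ht.2.2 i hi).le] at hx
    rw [← oddHalf_neg, zigzag, zigzag_succ_of_ge hz ((hzt i hi.le).1.trans hx.1), ← max_neg_neg,
      neg_neg, neg_sub, min_comm]
  have hnodes : ∀ i ≤ n, ∫ x in a..(t i), g x = 0 := by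
    intro i
    induction i with
    | zero => simp [ht.1]
    | succ i ih =>
      intro hi
      rw [← intervalIntegral.integral_add_adjacent_intervals (hint a (t i)) (hint _ _),
        ih (by omega), hstep i hi, add_zero]
  have hd : 0 ≤ (b - a) / n / 2 := by
    have := sub_pos.2 hab
    positivity
  refine ⟨g, hg, fun x y => (hω.abs_oddHalf_sub_le hconc _ _).trans
    (hω.2.2.1 (mem_Ici.2 (abs_nonneg _)) (mem_Ici.2 (abs_nonneg _)) (abs_zigzag_sub_le _ _ _)),
    hnodes, ?_⟩
  have hV := hω.integral_oddHalf hd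
  rw [mul_div_cancel₀ _ (two_ne_zero' ℝ)] at hV
  rw [← hV]
  rcases exists_large_gap (a := a) (b := b) hn z with h | h | ⟨k, hk1, hkn, h⟩
  · have hmem := hzmem 1 le_rfl hn
    refine ⟨z 1, hmem, ?_⟩
    obtain ⟨ε, hε1, hε⟩ := exists_sign_integral_comp_zigzag_eq hz (oddHalf_neg (ω := ω))
      (show 1 ≤ n + 1 by omega)
    have he : ∫ x in a..(z 1), φ (zigzag z 1 x) = ∫ y in (0 : ℝ)..(z 1 - a), φ y := by
      rw [← sub_self (z 1), ← intervalIntegral.integral_comp_sub_left]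
      refine intervalIntegral.integral_congr fun x hx => ?_
      rw [uIcc_of_le hmem.1] at hx
      rw [zigzag_succ_of_ge hz (by linarith [hx.1]), min_eq_right (by linarith [hx.1, hmem.2])]
    rw [hε _ _ hmem.1 le_rfl, abs_mul, hε1, one_mul, he]
    exact (hω.integral_oddHalf_mono hd h).trans (le_abs_self _)
  · have hmem := hzmem n hn le_rfl
    refine ⟨z n, hmem, ?_⟩
    have he : ∫ x in (z n)..b, g x = ∫ y in (0 : ℝ)..(b - z n), φ y := by
      rw [← sub_self (z n), ← intervalIntegral.integral_comp_sub_right]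
      refine intervalIntegral.integral_congr fun x hx => ?_
      rw [uIcc_of_le hmem.2] at hx
      simp only [g]
      rw [zigzag_succ_of_ge hz hx.1, min_eq_left (by linarith [hx.2, hmem.1])]
    have hsum := intervalIntegral.integral_add_adjacent_intervals (hint a (z n)) (hint (z n) b)
    have hb := hnodes n le_rfl
    rw [ht.2.1] at hb
    rw [hb] at hsum
    rw [eq_neg_of_add_eq_zero_left hsum, abs_neg, he]
    exact (hω.integral_oddHalf_mono hd h).trans (le_abs_self _)
  · have hle := hz (Nat.le_succ k)
    obtain ⟨ε, hε1, hε⟩ := exists_sign_integral_comp_zigzag_eq hz (oddHalf_neg (ω := ω))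
      (show k + 1 ≤ n + 1 by omega)
    have he : ∫ x in (z k)..(z (k + 1)), φ (zigzag z (k + 1) x) =
        2 * ∫ y in (0 : ℝ)..((z (k + 1) - z k) / 2), φ y := by
      rw [← integral_comp_min_sub hφ hle]
      refine intervalIntegral.integral_congr fun x hx => ?_
      rw [uIcc_of_le hle] at hx
      rw [zigzag_succ_of_ge hz hx.1]
    have hgap : 2 * ∫ y in (0 : ℝ)..((b - a) / n / 2), φ y ≤ |∫ x in (z k)..(z (k + 1)), g x| := by
      rw [hε _ _ hle le_rfl, abs_mul, hε1, one_mul, he]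
      exact (mul_le_mul_of_nonneg_left (hω.integral_oddHalf_mono hd h) zero_le_two).trans
        (le_abs_self _)
    rw [← intervalIntegral.integral_interval_sub_left (hint a _) (hint a _)] at hgap
    have htri := abs_sub (∫ x in a..(z (k + 1)), g x) (∫ x in a..(z k), g x)
    by_contra! hcon
    have h1 := hcon _ (hzmem k hk1 hkn.le)
    have h2 := hcon _ (hzmem (k + 1) (by omega) hkn)
    linarith

end LowerBound

/-- Optimal recovery of the identity operator on `W¹H^ω([a,b],E)` (concave `ω`) from values of
the function at `n + 1` partition points: the optimal error equals
`(1/4) ∫_0^{(b−a)/n} ω(t) dt`; it is attained at the uniform partition together with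
piecewise-linear interpolation. -/
theorem optimal_recovery_function_values
    {E : Type*} [NormedAddCommGroup E] [NormedSpace ℝ E] [CompleteSpace E] [Nontrivial E]
    (ω : ℝ → ℝ) (hω : IsModulus ω) (hconc : ConcaveOn ℝ (Set.Ici 0) ω)
    (a b : ℝ) (hab : a < b) (n : ℕ) (hn : 0 < n) :
    (IsPartition a b n (unifPt a b n) ∧
      ∀ f f' : ℝ → E, W1HHolder ω a b f f' → ∀ u ∈ Set.Icc a b,
        ‖f u - linMethod a b n (fun i : Fin (n + 1) => f (unifPt a b n (i : ℕ))) u‖ ≤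
          (1 / 4) * ∫ s in (0:ℝ)..((b - a) / (n : ℝ)), ω s) ∧
    ∀ t : ℕ → ℝ, IsPartition a b n t → ∀ Φ : (Fin (n + 1) → E) → ℝ → E, ∀ c : ℝ,
      (∀ f f' : ℝ → E, W1HHolder ω a b f f' → ∀ u ∈ Set.Icc a b,
        ‖f u - Φ (fun i : Fin (n + 1) => f (t (i : ℕ))) u‖ ≤ c) →
      (1 / 4) * ∫ s in (0:ℝ)..((b - a) / (n : ℝ)), ω s ≤ c := by
  refine ⟨⟨isPartition_unifPt hab hn, fun f f' hf u hu => ?_⟩, fun t ht Φ c hΦ => ?_⟩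
  · have hn' : (0 : ℝ) < n := by exact_mod_cast hn
    have hba : 0 < b - a := sub_pos.2 hab
    have hk : unifIdx a b n u + 1 ≤ n := by
      unfold unifIdx
      omega
    have hpart := isPartition_unifPt hab hn
    have hw := unifPt_succ_sub a b n (unifIdx a b n u)
    have h := norm_sub_linear_interpolation_le hω (hpart.mem_Icc (by omega)).1
      (hpart.mem_Icc hk).2 (hpart.2.2 _ hk) (mem_Icc_unifPt_unifIdx hab hn hu) hf
    rw [hw] at h
    simpa only [linMethod, dif_pos hn, div_div_eq_mul_div] using h
  · obtain ⟨g, hg, hgω, hnodes, u, hu, hle⟩ := exists_holder_integral_eq_zero hω hconc hab hn ht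
    obtain ⟨e, he⟩ := exists_norm_eq E zero_le_one
    have hmem : ∀ σ : ℝ, |σ| = 1 → W1HHolder ω a b
        (fun x => (∫ y in a..x, g y) • (σ • e)) (fun x => g x • (σ • e)) := by
      refine fun σ hσ => ⟨fun x _ =>
        ((hg.integral_hasStrictDerivAt a x).hasDerivAt.smul_const _).hasDerivWithinAt,
        fun x _ y _ => ?_⟩
      rw [← sub_smul, norm_smul, norm_smul, he, Real.norm_eq_abs, Real.norm_eq_abs, hσ, mul_one,
        mul_one]
      exact hgω y x
    have hdata : ∀ σ : ℝ, (fun i : Fin (n + 1) => (∫ y in a..(t (i : ℕ)), g y) • (σ • e)) =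
        fun _ => 0 := fun σ => funext fun i => by
      rw [hnodes i (Nat.lt_succ_iff.1 i.2), zero_smul]
    have h1 := hΦ _ _ (hmem 1 (by simp)) u hu
    have h2 := hΦ _ _ (hmem (-1) (by simp)) u hu
    simp only [hdata] at h1 h2
    have h3 := norm_sub_le_norm_sub_add_norm_sub ((∫ y in a..u, g y) • ((1 : ℝ) • e))
      (Φ (fun _ => 0) u) ((∫ y in a..u, g y) • ((-1 : ℝ) • e))
    rw [norm_sub_rev (Φ _ _)] at h3
    have h4 : (∫ y in a..u, g y) • ((1 : ℝ) • e) - (∫ y in a..u, g y) • ((-1 : ℝ) • e) =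
        (2 * ∫ y in a..u, g y) • e := by module
    rw [h4, norm_smul, he, mul_one, Real.norm_eq_abs, abs_mul, abs_two] at h3
    linarith
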